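/- (Lemma 1, Laplacian part.) Let Φ : U → ℝ be smooth with □Φ + 3Φ = 0 on U. Then the symmetric tensor T_{ab} = D_aD_bΦ + h⁰_{ab}Φ satisfies the tensor equation □T_{ab} = 3 T_{ab} at every point of U, where □T_{ab} = Σ_{c,d} h⁰^{cd} D_dD_cT_{ab} and the second covariant derivative treats D_cT_{ab} as a 3-tensor. -/

import Mathlib

noncomputable section

/-- Points of the chart `U = ℝ × (0,π) × ℝ` with coordinates `(τ, θ, φ)`. -/
abbrev Pt : Type := Fin 3 → ℝ

/-- The coordinate domain `U = ℝ × (0,π) × ℝ`. -/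
def U : Set Pt := {x | 0 < x 1 ∧ x 1 < Real.pi}

/-- Partial derivative `∂_i f` at `x`. -/
noncomputable def pd (i : Fin 3) (f : Pt → ℝ) (x : Pt) : ℝ :=
  deriv (fun t => f (Function.update x i t)) (x i)

/-- The unit-hyperboloid (dS₃) metric `h⁰_{ab}`. -/
noncomputable def h0 (x : Pt) : Fin 3 → Fin 3 → ℝ :=
  ![![-1, 0, 0],
    ![0, Real.cosh (x 0) ^ 2, 0],
    ![0, 0, Real.cosh (x 0) ^ 2 * Real.sin (x 1) ^ 2]]

/-- The inverse metric `h⁰^{ab}`. -/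
noncomputable def h0inv (x : Pt) : Fin 3 → Fin 3 → ℝ :=
  ![![-1, 0, 0],
    ![0, 1 / Real.cosh (x 0) ^ 2, 0],
    ![0, 0, 1 / (Real.cosh (x 0) ^ 2 * Real.sin (x 1) ^ 2)]]

/-- Christoffel symbols `Γ^c_{ab}` of `h⁰`; first index is the upper index. -/
noncomputable def Chr (x : Pt) : Fin 3 → Fin 3 → Fin 3 → ℝ :=
  ![![![0, 0, 0],
      ![0, Real.sinh (x 0) * Real.cosh (x 0), 0],
      ![0, 0, Real.sinh (x 0) * Real.cosh (x 0) * Real.sin (x 1) ^ 2]],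
    ![![0, Real.tanh (x 0), 0],
      ![Real.tanh (x 0), 0, 0],
      ![0, 0, -(Real.sin (x 1) * Real.cos (x 1))]],
    ![![0, 0, Real.tanh (x 0)],
      ![0, 0, Real.cos (x 1) / Real.sin (x 1)],
      ![Real.tanh (x 0), Real.cos (x 1) / Real.sin (x 1), 0]]]

/-- Covariant Hessian `D_a D_b f = ∂_a ∂_b f - Σ_c Γ^c_{ab} ∂_c f`. -/
noncomputable def hess (f : Pt → ℝ) (x : Pt) (a b : Fin 3) : ℝ :=
  pd a (pd b f) x - ∑ c, Chr x c a b * pd c f x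

/-- Covariant derivative `D_c T_{ab}` of a 2-tensor. -/
noncomputable def covD (T : Pt → Fin 3 → Fin 3 → ℝ) (x : Pt) (c a b : Fin 3) : ℝ :=
  pd c (fun y => T y a b) x - (∑ d, Chr x d c a * T x d b) - (∑ d, Chr x d c b * T x a d)

/-- Second covariant derivative `D_d D_c T_{ab}`, treating `D_c T_{ab}` as a 3-tensor. -/
noncomputable def covD2 (T : Pt → Fin 3 → Fin 3 → ℝ) (x : Pt) (d c a b : Fin 3) : ℝ :=
  pd d (fun y => covD T y c a b) x
    - (∑ e, Chr x e d c * covD T x e a b)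
    - (∑ e, Chr x e d a * covD T x c e b)
    - (∑ e, Chr x e d b * covD T x c a e)

/-- Tensor Laplacian `□T_{ab} = Σ_{c,d} h⁰^{cd} D_d D_c T_{ab}`. -/
noncomputable def boxT (T : Pt → Fin 3 → Fin 3 → ℝ) (x : Pt) (a b : Fin 3) : ℝ :=
  ∑ c, ∑ d, h0inv x c d * covD2 T x d c a b

/-- Totally antisymmetric Levi-Civita symbol with `levi 0 1 2 = 1`. -/
def levi : Fin 3 → Fin 3 → Fin 3 → ℝ :=
  ![![![0, 0, 0], ![0, 0, 1], ![0, -1, 0]],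
    ![![0, 0, -1], ![0, 0, 0], ![1, 0, 0]],
    ![![0, 1, 0], ![-1, 0, 0], ![0, 0, 0]]]

/-- Volume tensor `ε_{abc}` with `ε_{τθφ} = cosh²τ sinθ`. -/
noncomputable def epsLow (x : Pt) (a b c : Fin 3) : ℝ :=
  levi a b c * (Real.cosh (x 0) ^ 2 * Real.sin (x 1))

/-- `ε_a{}^{cd} = Σ_{e,f} ε_{aef} h⁰^{ec} h⁰^{fd}`. -/
noncomputable def epsMixed (x : Pt) (a c d : Fin 3) : ℝ :=
  ∑ e, ∑ f, epsLow x a e f * h0inv x e c * h0inv x f d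

/-- Curl of a 2-tensor: `(curl T)_{ab} = Σ_{c,d} ε_a{}^{cd} D_c T_{db}`. -/
noncomputable def curlT (T : Pt → Fin 3 → Fin 3 → ℝ) (x : Pt) (a b : Fin 3) : ℝ :=
  ∑ c, ∑ d, epsMixed x a c d * covD T x c d b

/-- Scalar Laplacian `□Φ = Σ_{a,b} h⁰^{ab} D_a D_b Φ`. -/
noncomputable def boxScalar (f : Pt → ℝ) (x : Pt) : ℝ :=
  ∑ a, ∑ b, h0inv x a b * hess f x a b

open scoped ContDiff

/-- Smoothness at every point of the chart domain `U`. -/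
def SmoothOnChart (f : Pt → ℝ) : Prop := ∀ x ∈ U, ContDiffAt ℝ ∞ f x

theorem isOpen_U : IsOpen U :=
  (isOpen_lt continuous_const (continuous_apply 1)).inter
    (isOpen_lt (continuous_apply 1) continuous_const)

theorem sin_ne_zero_of_mem_U {x : Pt} (hx : x ∈ U) : Real.sin (x 1) ≠ 0 :=
  (Real.sin_pos_of_pos_of_lt_pi hx.1 hx.2).ne'

namespace SmoothOnChart

variable {f g : Pt → ℝ}

theorem add (hf : SmoothOnChart f) (hg : SmoothOnChart g) :
    SmoothOnChart (fun y => f y + g y) := fun x hx => (hf x hx).add (hg x hx)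

theorem sub (hf : SmoothOnChart f) (hg : SmoothOnChart g) :
    SmoothOnChart (fun y => f y - g y) := fun x hx => (hf x hx).sub (hg x hx)

theorem mul (hf : SmoothOnChart f) (hg : SmoothOnChart g) :
    SmoothOnChart (fun y => f y * g y) := fun x hx => (hf x hx).mul (hg x hx)

theorem sum {F : Fin 3 → Pt → ℝ} (hF : ∀ d, SmoothOnChart (F d)) :
    SmoothOnChart (fun y => ∑ d, F d y) :=
  fun x hx => ContDiffAt.sum fun d _ => hF d x hx

theorem differentiableAt (hf : SmoothOnChart f) {x : Pt} (hx : x ∈ U) :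
    DifferentiableAt ℝ f x := (hf x hx).differentiableAt (by simp)

theorem hasDerivAt_update (hf : SmoothOnChart f) {x : Pt} (hx : x ∈ U) (i : Fin 3) :
    HasDerivAt (fun t => f (Function.update x i t)) (fderiv ℝ f x (Pi.single i 1)) (x i) := by
  have h : HasFDerivAt f (fderiv ℝ f x) (Function.update x i (x i)) := by
    simpa using (hf.differentiableAt hx).hasFDerivAt
  exact h.comp_hasDerivAt (x i) (_root_.hasDerivAt_update x i (x i))

theorem pd_eq_fderiv (hf : SmoothOnChart f) {x : Pt} (hx : x ∈ U) (i : Fin 3) :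
    pd i f x = fderiv ℝ f x (Pi.single i 1) := (hf.hasDerivAt_update hx i).deriv

theorem pd_eventuallyEq (hf : SmoothOnChart f) {x : Pt} (hx : x ∈ U) (i : Fin 3) :
    pd i f =ᶠ[nhds x] fun y => fderiv ℝ f y (Pi.single i 1) :=
  Filter.eventuallyEq_of_mem (isOpen_U.mem_nhds hx) fun _ hy => hf.pd_eq_fderiv hy i

protected theorem pd (hf : SmoothOnChart f) (i : Fin 3) : SmoothOnChart (pd i f) :=
  fun x hx => (((hf x hx).fderiv_right (m := ∞) (by simp)).clm_apply
    contDiffAt_const).congr_of_eventuallyEq (hf.pd_eventuallyEq hx i)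

end SmoothOnChart

section PartialDerivatives

variable {f g : Pt → ℝ} {x : Pt}

theorem pd_congr (h : ∀ y ∈ U, f y = g y) (hx : x ∈ U) (i : Fin 3) : pd i f x = pd i g x := by
  refine Filter.EventuallyEq.deriv_eq ?_
  have hc : Filter.Tendsto (fun t => Function.update x i t) (nhds (x i)) (nhds x) := by
    simpa using (hasDerivAt_update x i (x i)).continuousAt.tendsto
  exact (hc.eventually (isOpen_U.mem_nhds hx)).mono fun t ht => h _ ht

theorem pd_add (hf : SmoothOnChart f) (hg : SmoothOnChart g) (hx : x ∈ U) (i : Fin 3) :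
    pd i (fun y => f y + g y) x = pd i f x + pd i g x := by
  rw [hf.pd_eq_fderiv hx, hg.pd_eq_fderiv hx]
  exact ((hf.hasDerivAt_update hx i).add (hg.hasDerivAt_update hx i)).deriv

theorem pd_sub (hf : SmoothOnChart f) (hg : SmoothOnChart g) (hx : x ∈ U) (i : Fin 3) :
    pd i (fun y => f y - g y) x = pd i f x - pd i g x := by
  rw [hf.pd_eq_fderiv hx, hg.pd_eq_fderiv hx]
  exact ((hf.hasDerivAt_update hx i).sub (hg.hasDerivAt_update hx i)).deriv

theorem pd_mul (hf : SmoothOnChart f) (hg : SmoothOnChart g) (hx : x ∈ U) (i : Fin 3) :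
    pd i (fun y => f y * g y) x = pd i f x * g x + f x * pd i g x := by
  rw [hf.pd_eq_fderiv hx, hg.pd_eq_fderiv hx]
  exact ((hf.hasDerivAt_update hx i).fun_mul (hg.hasDerivAt_update hx i)).deriv.trans (by simp)

theorem pd_sum {F : Fin 3 → Pt → ℝ} (hF : ∀ d, SmoothOnChart (F d)) (hx : x ∈ U) (i : Fin 3) :
    pd i (fun y => ∑ d, F d y) x = ∑ d, pd i (F d) x := by
  simp only [fun d => (hF d).pd_eq_fderiv hx]
  exact (HasDerivAt.fun_sum fun d _ => (hF d).hasDerivAt_update hx i).deriv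

theorem pd_comm (hf : SmoothOnChart f) (hx : x ∈ U) (i j : Fin 3) :
    pd i (pd j f) x = pd j (pd i f) x := by
  have key : ∀ i j, pd i (pd j f) x
      = fderiv ℝ (fderiv ℝ f) x (Pi.single i 1) (Pi.single j 1) := by
    intro i j
    rw [(hf.pd j).pd_eq_fderiv hx, (hf.pd_eventuallyEq hx j).fderiv_eq]
    have hd : DifferentiableAt ℝ (fderiv ℝ f) x :=
      ((hf x hx).fderiv_right (m := ∞) (by simp)).differentiableAt (by simp)
    simp [fderiv_clm_apply hd (differentiableAt_const _)]
  rw [key, key]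
  exact ((hf x hx).isSymmSndFDerivAt (by simpa using WithTop.coe_le_coe.2 (le_top : (2 : ℕ∞) ≤ ⊤))).eq _ _

end PartialDerivatives

section Geometry

variable {x : Pt}

theorem Chr_symm (x : Pt) (e a b : Fin 3) : Chr x e a b = Chr x e b a := by
  fin_cases e <;> fin_cases a <;> fin_cases b <;> rfl

theorem h0_symm (x : Pt) (a b : Fin 3) : h0 x a b = h0 x b a := by
  fin_cases a <;> fin_cases b <;> rfl

theorem smoothOnChart_h0 (a b : Fin 3) : SmoothOnChart (fun y => h0 y a b) := by
  intro x _
  refine ContDiff.contDiffAt ?_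
  fin_cases a <;> fin_cases b <;> (simp [h0]; fun_prop)

theorem smoothOnChart_h0inv (a b : Fin 3) : SmoothOnChart (fun y => h0inv y a b) := by
  intro x hx
  have hs := sin_ne_zero_of_mem_U hx
  have hc := (Real.cosh_pos (x 0)).ne'
  fin_cases a <;> fin_cases b <;> simp [h0inv] <;> fun_prop (disch := simp [hs, hc])

theorem smoothOnChart_Chr (e a b : Fin 3) : SmoothOnChart (fun y => Chr y e a b) := by
  intro x hx
  have hs := sin_ne_zero_of_mem_U hx
  have hc := (Real.cosh_pos (x 0)).ne'
  fin_cases e <;> fin_cases a <;> fin_cases b <;> simp [Chr, Real.tanh_eq_sinh_div_cosh] <;>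
    fun_prop (disch := simp [hs, hc])

/-- Partial derivatives `∂_i Γ^e_{ab}`; the first index is the direction. -/
def dChr (x : Pt) : Fin 3 → Fin 3 → Fin 3 → Fin 3 → ℝ :=
  ![![![![0, 0, 0],
        ![0, Real.cosh (x 0) ^ 2 + Real.sinh (x 0) ^ 2, 0],
        ![0, 0, (Real.cosh (x 0) ^ 2 + Real.sinh (x 0) ^ 2) * Real.sin (x 1) ^ 2]],
      ![![0, 1 / Real.cosh (x 0) ^ 2, 0],
        ![1 / Real.cosh (x 0) ^ 2, 0, 0],
        ![0, 0, 0]],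
      ![![0, 0, 1 / Real.cosh (x 0) ^ 2],
        ![0, 0, 0],
        ![1 / Real.cosh (x 0) ^ 2, 0, 0]]],
    ![![![0, 0, 0],
        ![0, 0, 0],
        ![0, 0, 2 * Real.sinh (x 0) * Real.cosh (x 0) * (Real.sin (x 1) * Real.cos (x 1))]],
      ![![0, 0, 0],
        ![0, 0, 0],
        ![0, 0, Real.sin (x 1) ^ 2 - Real.cos (x 1) ^ 2]],
      ![![0, 0, 0],
        ![0, 0, -(1 / Real.sin (x 1) ^ 2)],
        ![0, -(1 / Real.sin (x 1) ^ 2), 0]]],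
    fun _ _ _ => 0]

theorem hasDerivAt_tanh (t : ℝ) : HasDerivAt Real.tanh (1 / Real.cosh t ^ 2) t := by
  have hc := (Real.cosh_pos t).ne'
  have h := (Real.hasDerivAt_sinh t).div (Real.hasDerivAt_cosh t) hc
  have e : Real.tanh = Real.sinh / Real.cosh := funext Real.tanh_eq_sinh_div_cosh
  rw [e]
  refine h.congr_deriv ?_
  congr 1
  linarith [Real.cosh_sq_sub_sinh_sq t]

theorem hasDerivAt_cot {t : ℝ} (h : Real.sin t ≠ 0) :
    HasDerivAt (fun s => Real.cos s / Real.sin s) (-(1 / Real.sin t ^ 2)) t := by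
  refine ((Real.hasDerivAt_cos t).fun_div (Real.hasDerivAt_sin t) h).congr_deriv ?_
  rw [← neg_div]
  congr 1
  linarith [Real.sin_sq_add_cos_sq t]

theorem hasDerivAt_sinh_mul_cosh (t : ℝ) :
    HasDerivAt (fun s => Real.sinh s * Real.cosh s) (Real.cosh t ^ 2 + Real.sinh t ^ 2) t := by
  refine ((Real.hasDerivAt_sinh t).fun_mul (Real.hasDerivAt_cosh t)).congr_deriv ?_
  ring

theorem hasDerivAt_sin_sq (t : ℝ) :
    HasDerivAt (fun s => Real.sin s ^ 2) (2 * Real.sin t * Real.cos t) t := by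
  simpa using (Real.hasDerivAt_sin t).fun_pow 2

theorem hasDerivAt_cosh_sq (t : ℝ) :
    HasDerivAt (fun s => Real.cosh s ^ 2) (2 * Real.cosh t * Real.sinh t) t := by
  simpa using (Real.hasDerivAt_cosh t).fun_pow 2

theorem hasDerivAt_neg_sin_mul_cos (t : ℝ) :
    HasDerivAt (fun s => -(Real.sin s * Real.cos s)) (Real.sin t ^ 2 - Real.cos t ^ 2) t := by
  refine ((Real.hasDerivAt_sin t).fun_mul (Real.hasDerivAt_cos t)).fun_neg.congr_deriv ?_
  ring

theorem pd_Chr (hx : x ∈ U) (i e a b : Fin 3) :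
    pd i (fun y => Chr y e a b) x = dChr x i e a b := by
  have hs := sin_ne_zero_of_mem_U hx
  have h1 := (hasDerivAt_sinh_mul_cosh (x 0)).deriv
  have h2 := (hasDerivAt_tanh (x 0)).deriv
  have h3 := (hasDerivAt_cot hs).deriv
  have h4 := (hasDerivAt_neg_sin_mul_cos (x 1)).deriv
  have h5 := ((hasDerivAt_sinh_mul_cosh (x 0)).mul_const (Real.sin (x 1) ^ 2)).deriv
  have h6 := ((hasDerivAt_sin_sq (x 1)).const_mul (Real.sinh (x 0) * Real.cosh (x 0))).deriv
  fin_cases i <;> fin_cases e <;> fin_cases a <;> fin_cases b <;>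
    simp only [pd, Chr, dChr, Function.update_apply, Fin.zero_eta, Fin.mk_one, Fin.reduceFinMk,
      Fin.isValue, Fin.reduceEq, if_true, if_false, deriv_const, h1, h2, h3, h4, h5, h6,
      Matrix.cons_val]
  ring

theorem pd_h0 (hx : x ∈ U) (i a b : Fin 3) :
    pd i (fun y => h0 y a b) x
      = ∑ f, (Chr x f i a * h0 x f b + Chr x f i b * h0 x a f) := by
  have hs := sin_ne_zero_of_mem_U hx
  have hcosh := (Real.cosh_pos (x 0)).ne'
  have h1 := (hasDerivAt_cosh_sq (x 0)).deriv
  have h2 := ((hasDerivAt_cosh_sq (x 0)).mul_const (Real.sin (x 1) ^ 2)).deriv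
  have h3 := ((hasDerivAt_sin_sq (x 1)).const_mul (Real.cosh (x 0) ^ 2)).deriv
  rw [Fin.sum_univ_three]
  fin_cases i <;> fin_cases a <;> fin_cases b <;>
    simp only [pd, Chr, h0, Function.update_apply, Fin.zero_eta, Fin.mk_one, Fin.reduceFinMk,
      Fin.isValue, Fin.reduceEq, if_true, if_false, deriv_const, h1, h2, h3,
      Real.tanh_eq_sinh_div_cosh, Matrix.cons_val] <;> field_simp <;> ring

theorem sum_h0inv_mul_h0 (hx : x ∈ U) (a b : Fin 3) :
    ∑ c, h0inv x a c * h0 x c b = if a = b then 1 else 0 := by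
  have hs := sin_ne_zero_of_mem_U hx
  have hcosh := (Real.cosh_pos (x 0)).ne'
  rw [Fin.sum_univ_three]
  fin_cases a <;> fin_cases b <;> simp [h0, h0inv, hcosh]
  field_simp

theorem h0inv_symm (x : Pt) (a b : Fin 3) : h0inv x a b = h0inv x b a := by
  fin_cases a <;> fin_cases b <;> rfl

theorem sum_h0inv_mul_h0_mul (hx : x ∈ U) (b : Fin 3) (v : Fin 3 → ℝ) :
    ∑ c, ∑ d, h0inv x c d * (h0 x d b * v c) = v b := by
  simp only [← mul_assoc, ← Finset.sum_mul, sum_h0inv_mul_h0 hx]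
  simp

theorem sum_h0inv_mul_h0_mul' (hx : x ∈ U) (a : Fin 3) (v : Fin 3 → ℝ) :
    ∑ c, ∑ d, h0inv x c d * (h0 x a c * v d) = v a := by
  rw [Finset.sum_comm, ← sum_h0inv_mul_h0_mul hx a v]
  refine Finset.sum_congr rfl fun c _ => Finset.sum_congr rfl fun d _ => ?_
  rw [h0inv_symm, h0_symm]

theorem sum_h0inv_mul_h0_eq_three (hx : x ∈ U) : ∑ a, ∑ b, h0inv x a b * h0 x b a = 3 := by
  simp [sum_h0inv_mul_h0 hx]

theorem hasDerivAt_one_div_cosh_sq (t : ℝ) :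
    HasDerivAt (fun s => 1 / Real.cosh s ^ 2) (-(2 * Real.sinh t / Real.cosh t ^ 3)) t := by
  have hc := (Real.cosh_pos t).ne'
  refine ((hasDerivAt_const t (1 : ℝ)).fun_div (hasDerivAt_cosh_sq t)
    (by positivity)).congr_deriv ?_
  field_simp
  ring

theorem hasDerivAt_one_div_sin_sq {t : ℝ} (h : Real.sin t ≠ 0) :
    HasDerivAt (fun s => 1 / Real.sin s ^ 2) (-(2 * Real.cos t / Real.sin t ^ 3)) t := by
  refine ((hasDerivAt_const t (1 : ℝ)).fun_div (hasDerivAt_sin_sq t)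
    (by positivity)).congr_deriv ?_
  field_simp
  ring

theorem pd_h0inv (hx : x ∈ U) (i a b : Fin 3) :
    pd i (fun y => h0inv y a b) x
      = -∑ f, (Chr x a i f * h0inv x f b + Chr x b i f * h0inv x a f) := by
  have hs := sin_ne_zero_of_mem_U hx
  have hcosh := (Real.cosh_pos (x 0)).ne'
  have h1 := (hasDerivAt_one_div_cosh_sq (x 0)).deriv
  have h2 := ((hasDerivAt_one_div_cosh_sq (x 0)).mul_const (1 / Real.sin (x 1) ^ 2)).deriv
  have h3 := ((hasDerivAt_one_div_sin_sq hs).const_mul (1 / Real.cosh (x 0) ^ 2)).deriv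
  rw [Fin.sum_univ_three]
  fin_cases i <;> fin_cases a <;> fin_cases b <;>
    simp only [pd, Chr, h0inv, Function.update_apply, Fin.zero_eta, Fin.mk_one, Fin.reduceFinMk,
      Fin.isValue, Fin.reduceEq, if_true, if_false, deriv_const, h1, h2, h3,
      ← one_div_mul_one_div,
      Real.tanh_eq_sinh_div_cosh, Matrix.cons_val] <;> field_simp <;> ring

/-- The hyperboloid has unit constant curvature:
`R^e_{acd} = δ^e_c h⁰_{da} - δ^e_d h⁰_{ca}`. -/
theorem riemann_eq (hx : x ∈ U) (e a c d : Fin 3) :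
    pd c (fun y => Chr y e d a) x - pd d (fun y => Chr y e c a) x
        + ∑ f, (Chr x e c f * Chr x f d a - Chr x e d f * Chr x f c a)
      = (if e = c then 1 else 0) * h0 x d a - (if e = d then 1 else 0) * h0 x c a := by
  have hs := sin_ne_zero_of_mem_U hx
  have hcosh := (Real.cosh_pos (x 0)).ne'
  have hcs : Real.cosh (x 0) ^ 2 = Real.sinh (x 0) ^ 2 + 1 := Real.cosh_sq _
  have hsc : Real.cos (x 1) ^ 2 = 1 - Real.sin (x 1) ^ 2 := Real.cos_sq' _
  rw [pd_Chr hx, pd_Chr hx, Fin.sum_univ_three]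
  fin_cases e <;> fin_cases a <;> fin_cases c <;> fin_cases d <;>
    simp only [Chr, dChr, h0, Fin.zero_eta, Fin.mk_one, Fin.reduceFinMk,
      Fin.isValue, Fin.reduceEq, if_true, if_false,
      Real.tanh_eq_sinh_div_cosh, Matrix.cons_val] <;> field_simp <;> grind

end Geometry

section TensorIdentities

variable {x : Pt}

theorem SmoothOnChart.hess {f : Pt → ℝ} (hf : SmoothOnChart f) (a b : Fin 3) :
    SmoothOnChart (fun y => hess f y a b) :=
  ((hf.pd b).pd a).sub (.sum fun c => (smoothOnChart_Chr c a b).mul (hf.pd c))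

theorem smoothOnChart_covD {T : Pt → Fin 3 → Fin 3 → ℝ}
    (hT : ∀ a b, SmoothOnChart (fun y => T y a b)) (c a b : Fin 3) :
    SmoothOnChart (fun y => covD T y c a b) :=
  (((hT a b).pd c).sub (.sum fun d => (smoothOnChart_Chr d c a).mul (hT d b))).sub
    (.sum fun d => (smoothOnChart_Chr d c b).mul (hT a d))

theorem hess_symm {f : Pt → ℝ} (hf : SmoothOnChart f) (hx : x ∈ U) (a b : Fin 3) :
    hess f x a b = hess f x b a := by
  simp only [hess, pd_comm hf hx a b, Chr_symm x _ a b]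

/-- Contraction of a family over `Fin 3` with a Kronecker delta. -/
theorem sum_ite_sub_ite_mul (v : Fin 3 → ℝ) (c d : Fin 3) (p q : ℝ) :
    ∑ e, ((if e = c then 1 else 0) * p - (if e = d then 1 else 0) * q) * v e
      = p * v c - q * v d := by
  simp [sub_mul, Finset.sum_sub_distrib]

/-- The Codazzi property: `D_c (D_a D_b f + h⁰_{ab} f)` is symmetric in `c` and `a`. -/
theorem covD_hess_add_symm {f : Pt → ℝ} (hf : SmoothOnChart f) (hx : x ∈ U) (c a b : Fin 3) :
    covD (fun y a' b' => hess f y a' b' + h0 y a' b' * f y) x c a b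
      = covD (fun y a' b' => hess f y a' b' + h0 y a' b' * f y) x a c b := by
  have hexp : ∀ c a b, pd c (fun y => hess f y a b + h0 y a b * f y) x
      = pd c (pd a (pd b f)) x
        - ∑ d, (pd c (fun y => Chr y d a b) x * pd d f x + Chr x d a b * pd c (pd d f) x)
        + ((∑ e, (Chr x e c a * h0 x e b + Chr x e c b * h0 x a e)) * f x
          + h0 x a b * pd c f x) := by
    intro c a b
    have hΓ : ∀ d, SmoothOnChart (fun y => Chr y d a b * pd d f y) :=
      fun d => (smoothOnChart_Chr d a b).mul (hf.pd d)
    rw [pd_add (hf.hess a b) ((smoothOnChart_h0 a b).mul hf) hx,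
      pd_mul (smoothOnChart_h0 a b) hf hx, pd_h0 hx]
    simp only [hess]
    rw [pd_sub ((hf.pd b).pd a) (.sum hΓ) hx, pd_sum hΓ hx]
    simp only [fun d => pd_mul (smoothOnChart_Chr d a b) (hf.pd d) hx c]
  have hR := sum_ite_sub_ite_mul (fun e => pd e f x) c a (h0 x a b) (h0 x c b)
  simp only [← riemann_eq hx] at hR
  simp only [covD, hexp]
  simp only [hess]
  rw [pd_comm (hf.pd b) hx c a]
  simp only [Fin.sum_univ_three, Chr_symm x _ a c] at hR ⊢
  linear_combination -hR

/-- The Ricci identity for a 2-tensor on the unit hyperboloid. -/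
theorem covD2_sub_covD2_swap {T : Pt → Fin 3 → Fin 3 → ℝ}
    (hT : ∀ a b, SmoothOnChart (fun y => T y a b)) (hx : x ∈ U) (d c a b : Fin 3) :
    covD2 T x d c a b - covD2 T x c d a b
      = -(h0 x c a * T x d b - h0 x d a * T x c b)
        - (h0 x c b * T x a d - h0 x d b * T x a c) := by
  have hexp : ∀ d c, pd d (fun y => covD T y c a b) x
      = pd d (pd c (fun y => T y a b)) x
        - (∑ e, (pd d (fun y => Chr y e c a) x * T x e b
            + Chr x e c a * pd d (fun y => T y e b) x))
        - ∑ e, (pd d (fun y => Chr y e c b) x * T x a e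
            + Chr x e c b * pd d (fun y => T y a e) x) := by
    intro d c
    have h1 : ∀ e, SmoothOnChart (fun y => Chr y e c a * T y e b) :=
      fun e => (smoothOnChart_Chr e c a).mul (hT e b)
    have h2 : ∀ e, SmoothOnChart (fun y => Chr y e c b * T y a e) :=
      fun e => (smoothOnChart_Chr e c b).mul (hT a e)
    simp only [covD]
    rw [pd_sub (((hT a b).pd c).sub (.sum h1)) (.sum h2) hx,
      pd_sub ((hT a b).pd c) (.sum h1) hx, pd_sum h1 hx, pd_sum h2 hx]
    simp only [fun e => pd_mul (smoothOnChart_Chr e c a) (hT e b) hx d,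
      fun e => pd_mul (smoothOnChart_Chr e c b) (hT a e) hx d]
  have hRa := sum_ite_sub_ite_mul (fun e => T x e b) d c (h0 x c a) (h0 x d a)
  have hRb := sum_ite_sub_ite_mul (fun e => T x a e) d c (h0 x c b) (h0 x d b)
  simp only [← riemann_eq hx] at hRa hRb
  simp only [covD2, hexp]
  rw [pd_comm (hT a b) hx d c, ← hRa, ← hRb]
  simp only [covD, Fin.sum_univ_three, Chr_symm x _ d c]
  ring

/-- The covariant derivative of a trace-free tensor is trace-free, by metric compatibility. -/
theorem sum_h0inv_mul_covD_eq_zero {T : Pt → Fin 3 → Fin 3 → ℝ}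
    (hT : ∀ a b, SmoothOnChart (fun y => T y a b))
    (htr : ∀ y ∈ U, ∑ a, ∑ b, h0inv y a b * T y a b = 0) (hx : x ∈ U) (c : Fin 3) :
    ∑ a, ∑ b, h0inv x a b * covD T x c a b = 0 := by
  have hterm : ∀ a b, SmoothOnChart (fun y => h0inv y a b * T y a b) :=
    fun a b => (smoothOnChart_h0inv a b).mul (hT a b)
  have h : pd c (fun y => ∑ a, ∑ b, h0inv y a b * T y a b) x = 0 := by
    rw [pd_congr (g := fun _ => 0) htr hx]
    simp [pd]
  rw [pd_sum (fun a => .sum (hterm a)) hx] at h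
  simp only [fun a => pd_sum (hterm a) hx c,
    fun a b => pd_mul (smoothOnChart_h0inv a b) (hT a b) hx c, pd_h0inv hx] at h
  rw [← h]
  simp only [covD, Fin.sum_univ_three]
  ring

theorem sum_h0inv_mul_covD2_eq_zero {T : Pt → Fin 3 → Fin 3 → ℝ}
    (hT : ∀ a b, SmoothOnChart (fun y => T y a b)) {b : Fin 3}
    (htr : ∀ e, ∀ y ∈ U, ∑ c, ∑ d, h0inv y c d * covD T y d c e = 0) (hx : x ∈ U) (a : Fin 3) :
    ∑ c, ∑ d, h0inv x c d * covD2 T x a d c b = 0 := by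
  have hD := smoothOnChart_covD hT
  have hterm : ∀ c d, SmoothOnChart (fun y => h0inv y c d * covD T y d c b) :=
    fun c d => (smoothOnChart_h0inv c d).mul (hD d c b)
  have h : pd a (fun y => ∑ c, ∑ d, h0inv y c d * covD T y d c b) x = 0 := by
    rw [pd_congr (g := fun _ => 0) (htr b) hx]
    simp [pd]
  rw [pd_sum (fun c => .sum (hterm c)) hx] at h
  simp only [fun c => pd_sum (hterm c) hx a,
    fun c d => pd_mul (smoothOnChart_h0inv c d) (hD d c b) hx a, pd_h0inv hx] at h
  have h0 := htr 0 x hx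
  have h1 := htr 1 x hx
  have h2 := htr 2 x hx
  simp only [covD2, Fin.sum_univ_three] at h h0 h1 h2 ⊢
  linear_combination h - Chr x 0 a b * h0 - Chr x 1 a b * h1 - Chr x 2 a b * h2

/-- A trace-free symmetric Codazzi tensor on the unit hyperboloid satisfies `□T = 3T`. -/
theorem boxT_eq_of_codazzi {T : Pt → Fin 3 → Fin 3 → ℝ}
    (hT : ∀ a b, SmoothOnChart (fun y => T y a b))
    (hsymm : ∀ y ∈ U, ∀ a b, T y a b = T y b a)
    (hcod : ∀ y ∈ U, ∀ c a b, covD T y c a b = covD T y a c b)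
    (htr : ∀ y ∈ U, ∑ a, ∑ b, h0inv y a b * T y a b = 0) (hx : x ∈ U) (a b : Fin 3) :
    boxT T x a b = 3 * T x a b := by
  have hDsymm : ∀ y ∈ U, ∀ c a b, covD T y c a b = covD T y c b a := by
    intro y hy c a b
    have h1 := fun d => hsymm y hy d b
    have h2 := fun d => hsymm y hy a d
    simp only [covD, Fin.sum_univ_three]
    rw [pd_congr (fun z hz => hsymm z hz a b) hy c]
    linear_combination -Chr y 0 c a * h1 0 - Chr y 1 c a * h1 1 - Chr y 2 c a * h1 2
      - Chr y 0 c b * h2 0 - Chr y 1 c b * h2 1 - Chr y 2 c b * h2 2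
  have hdiv : ∀ e, ∀ y ∈ U, ∑ c, ∑ d, h0inv y c d * covD T y d c e = 0 := by
    intro e y hy
    rw [← sum_h0inv_mul_covD_eq_zero hT htr hy e]
    refine Finset.sum_congr rfl fun c _ => Finset.sum_congr rfl fun d _ => ?_
    rw [hDsymm y hy d c e, hcod y hy d e c, hDsymm y hy e d c]
  have hcod2 : ∀ d c, covD2 T x d c a b = covD2 T x d a c b := by
    intro d c
    have h1 := fun e => hcod x hx e a b
    have h2 := fun e => hcod x hx c e b
    have h3 := fun e => hcod x hx c a e
    simp only [covD2, Fin.sum_univ_three]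
    rw [pd_congr (fun z hz => hcod z hz c a b) hx d]
    linear_combination -Chr x 0 d c * h1 0 - Chr x 1 d c * h1 1 - Chr x 2 d c * h1 2
      - Chr x 0 d a * h2 0 - Chr x 1 d a * h2 1 - Chr x 2 d a * h2 2
      - Chr x 0 d b * h3 0 - Chr x 1 d b * h3 1 - Chr x 2 d b * h3 2
  have hric : ∀ d c, covD2 T x d c a b
      = covD2 T x a d c b - (h0 x a c * T x d b - h0 x d c * T x a b)
        - (h0 x a b * T x c d - h0 x d b * T x c a) := by
    intro d c
    linear_combination hcod2 d c + covD2_sub_covD2_swap hT hx d a c b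
  have hzero := sum_h0inv_mul_covD2_eq_zero hT (b := b) hdiv hx a
  have htrx := htr x hx
  have h1 := sum_h0inv_mul_h0_mul' hx a fun d => T x d b
  have h2 := sum_h0inv_mul_h0_mul hx b fun c => T x c a
  have h3 := sum_h0inv_mul_h0_eq_three hx
  simp only [boxT, hric]
  simp only [Fin.sum_univ_three] at hzero htrx h1 h2 h3 ⊢
  linear_combination hzero - h1 + h2 + T x a b * h3 - h0 x a b * htrx + hsymm x hx b a

end TensorIdentities

/-- Lemma 1 (Laplacian part): if `□Φ + 3Φ = 0` then
`T_{ab} = D_aD_bΦ + h⁰_{ab}Φ` satisfies `□T_{ab} = 3 T_{ab}` on `U`. -/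
theorem stmt6 (Φ : Pt → ℝ) (hΦ : ContDiffOn ℝ (⊤ : ℕ∞) Φ U)
    (heq : ∀ x ∈ U, boxScalar Φ x + 3 * Φ x = 0) :
    ∀ x ∈ U, ∀ a b : Fin 3,
      boxT (fun y a' b' => hess Φ y a' b' + h0 y a' b' * Φ y) x a b
        = 3 * (hess Φ x a b + h0 x a b * Φ x) := by
  have hsm : SmoothOnChart Φ := fun x hx => hΦ.contDiffAt (isOpen_U.mem_nhds hx)
  intro x hx a b
  refine boxT_eq_of_codazzi
    (fun a b => (hsm.hess a b).add ((smoothOnChart_h0 a b).mul hsm))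
    (fun y hy a b => by rw [hess_symm hsm hy, h0_symm])
    (fun y hy => covD_hess_add_symm hsm hy) (fun y hy => ?_) hx a b
  have htrace : ∑ a, ∑ b, h0inv y a b * h0 y a b = 3 := by
    rw [← sum_h0inv_mul_h0_eq_three hy]
    exact Finset.sum_congr rfl fun a _ => Finset.sum_congr rfl fun b _ => by rw [h0_symm]
  rw [← heq y hy, ← htrace, boxScalar]
  simp only [Fin.sum_univ_three]
  ring
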